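/- arXiv:1409.8123 — 2 statements merged into one kernel-verified Lean document; each statement's English description precedes it below -/
import Mathlib

section
/- The number of maximal triangle-free graphs on the vertex set {1,...,n} is at most 2^{n^2/8 + o(n^2)}. Precisely: for every ε > 0 there exists N such that for all n ≥ N, the number of simple graphs H on vertex set Fin n that are maximal triangle-free (H contains no triangle, and adding any non-edge of H creates a triangle) is at most 2^{(1/8 + ε) n^2}. -/
/-- `H` is maximal triangle-free: `H` contains no triangle, and adding any non-edge of `H`
creates a triangle. -/
def MaximalTriangleFree {n : ℕ} (H : SimpleGraph (Fin n)) : Prop :=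
  H.CliqueFree 3 ∧ ∀ u v : Fin n, u ≠ v → ¬ H.Adj u v →
    ¬ (H ⊔ SimpleGraph.fromEdgeSet {s(u, v)}).CliqueFree 3

open Finset in
/-- Maximal independent subsets of `S`. -/
noncomputable def misFamily {α : Type*} (G : SimpleGraph α) (S : Finset α) : Finset (Finset α) := by
  classical
  exact S.powerset.filter (fun I => (∀ x ∈ I, ∀ y ∈ I, ¬ G.Adj x y) ∧
    ∀ x ∈ S, x ∉ I → ∃ y ∈ I, G.Adj x y)

lemma mem_misFamily {α : Type*} (G : SimpleGraph α) (S I : Finset α) :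
    I ∈ misFamily G S ↔ I ⊆ S ∧ (∀ x ∈ I, ∀ y ∈ I, ¬ G.Adj x y) ∧
    ∀ x ∈ S, x ∉ I → ∃ y ∈ I, G.Adj x y := by
  simp [misFamily]

open Classical in
/-- Maximal independent sets containing a given set `T`. -/
lemma mis_branch {α : Type*} (G : SimpleGraph α) (S T : Finset α) :
    ((misFamily G S).filter (fun I => T ⊆ I)).card ≤
      (misFamily G (S.filter (fun x => x ∉ T ∧ ∀ t ∈ T, ¬ G.Adj t x))).card := by
  apply Finset.card_le_card_of_injOn (fun I => I \ T)
  · intro I hI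
    simp only [Finset.coe_filter, Set.mem_ofPred_eq, mem_misFamily] at hI
    obtain ⟨⟨hS, hind, hmax⟩, hT⟩ := hI
    simp only [Finset.mem_coe, mem_misFamily]
    refine ⟨?_, ?_, ?_⟩
    · intro x hx
      simp only [Finset.mem_sdiff] at hx
      simp only [Finset.mem_filter]
      exact ⟨hS hx.1, hx.2, fun t ht => hind t (hT ht) x hx.1⟩
    · intro x hx y hy
      simp only [Finset.mem_sdiff] at hx hy
      exact hind x hx.1 y hy.1
    · intro x hx hxI
      simp only [Finset.mem_filter] at hx
      simp only [Finset.mem_sdiff, not_and, not_not] at hxI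
      obtain ⟨y, hy, hxy⟩ := hmax x hx.1 (fun h => hx.2.1 (hxI h))
      refine ⟨y, ?_, hxy⟩
      simp only [Finset.mem_sdiff]
      exact ⟨hy, fun hyT => hx.2.2 y hyT hxy.symm⟩
  · intro I hI J hJ h
    simp only [Finset.coe_filter, Set.mem_ofPred_eq] at hI hJ
    simp only at h
    rw [← Finset.sdiff_union_of_subset hI.2, ← Finset.sdiff_union_of_subset hJ.2, h]

lemma le_sqrt_two_pow (k : ℕ) (hk : k ≠ 3) : (k : ℝ) ≤ Real.sqrt 2 ^ k := by
  have key : ∀ k : ℕ, k ≠ 3 → k ^ 2 ≤ 2 ^ k := by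
    intro k hk
    rcases Nat.lt_or_ge k 4 with h | h
    · interval_cases k <;> simp_all
    · induction k, h using Nat.le_induction with
      | base => norm_num
      | succ m hm ih =>
        have := ih (by omega)
        rw [pow_succ 2 m]
        nlinarith
  have h1 : ((k : ℝ)) ^ 2 ≤ (Real.sqrt 2 ^ k) ^ 2 := by
    rw [← pow_mul, mul_comm, pow_mul, Real.sq_sqrt (by norm_num)]
    exact_mod_cast key k hk
  exact le_of_sq_le_sq h1 (by positivity)

open Classical in
/-- **Hujter–Tuza**: a triangle-free graph on `m` vertices has at most `2^(m/2)` maximal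
independent sets. -/
theorem hujter_tuza {α : Type*} (G : SimpleGraph α)
    (hG : ∀ x y z, G.Adj x y → G.Adj y z → ¬ G.Adj x z) (S : Finset α) :
    ((misFamily G S).card : ℝ) ≤ Real.sqrt 2 ^ S.card := by
  induction S using Finset.strongInduction with
  | H S ih =>
  set s : ℝ := Real.sqrt 2 with hs
  have hs2 : s ^ 2 = 2 := Real.sq_sqrt (by norm_num)
  have hs0 : 0 < s := by positivity
  have hs1 : 1 ≤ s := by nlinarith
  have hs15 : s ≤ 1.5 := by nlinarith
  -- branching bound
  have hbr : ∀ (T K : Finset α) (k : ℕ), 1 ≤ k → k ≤ K.card → K ⊆ S →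
      (∀ x ∈ K, x ∈ T ∨ ∃ t ∈ T, G.Adj t x) →
      (((misFamily G S).filter (fun I => T ⊆ I)).card : ℝ) ≤ s ^ S.card / s ^ k := by
    intro T K k hk1 hk hKS hK
    set S' := S.filter (fun x => x ∉ T ∧ ∀ t ∈ T, ¬ G.Adj t x) with hS'
    have hsub : S' ⊆ S \ K := by
      intro x hx
      simp only [hS', Finset.mem_filter] at hx
      simp only [Finset.mem_sdiff]
      refine ⟨hx.1, fun hxK => ?_⟩
      rcases hK x hxK with h | ⟨t, ht, h⟩
      · exact hx.2.1 h
      · exact hx.2.2 t ht h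
    have hc := Finset.card_le_card hsub
    have hc2 := Finset.card_sdiff_add_card_eq_card hKS
    have hlt : S' ⊂ S := by
      refine Finset.ssubset_iff_subset_ne.2 ⟨Finset.filter_subset _ _, fun h => ?_⟩
      have : S'.card = S.card := by rw [h]
      omega
    rw [le_div_iff₀ (by positivity)]
    calc _ ≤ ((misFamily G S').card : ℝ) * s ^ k := by
          refine mul_le_mul_of_nonneg_right ?_ (by positivity)
          exact_mod_cast mis_branch G S T
      _ ≤ s ^ S'.card * s ^ k := by
          gcongr
          exact ih S' hlt
      _ = s ^ (S'.card + k) := by rw [pow_add]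
      _ ≤ s ^ S.card := pow_le_pow_right₀ hs1 (by omega)
  rcases S.eq_empty_or_nonempty with rfl | hne
  · have : misFamily G ∅ ⊆ {∅} := by
      intro I hI
      rw [mem_misFamily] at hI
      simpa using hI.1
    have := Finset.card_le_card this
    simp at this ⊢
    exact_mod_cast this
  set N : α → Finset α := fun v => insert v (S.filter (G.Adj v)) with hN
  have hNS : ∀ v ∈ S, N v ⊆ S := by
    intro v hv x hx
    simp only [hN, Finset.mem_insert, Finset.mem_filter] at hx
    rcases hx with rfl | h
    · exact hv
    · exact h.1
  have hbr1 : ∀ v ∈ S, ∀ k, 1 ≤ k → k ≤ (N v).card →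
      (((misFamily G S).filter (fun I => {v} ⊆ I)).card : ℝ) ≤ s ^ S.card / s ^ k := by
    intro v hv k hk1 hk
    refine hbr {v} (N v) k hk1 hk (hNS v hv) ?_
    intro x hx
    simpa [hN] using (by
      simp only [hN, Finset.mem_insert, Finset.mem_filter] at hx
      tauto : x = v ∨ G.Adj v x)
  have hcov : ∀ v ∈ S, ∀ I ∈ misFamily G S, ∃ u ∈ N v, u ∈ I := by
    intro v hv I hI
    rw [mem_misFamily] at hI
    by_cases h : v ∈ I
    · exact ⟨v, by simp [hN], h⟩
    · obtain ⟨y, hy, hvy⟩ := hI.2.2 v hv h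
      exact ⟨y, by simp [hN, hvy, hI.1 hy], hy⟩
  obtain ⟨v, hv, hmin⟩ := Finset.exists_min_image S (fun v => (N v).card) hne
  have hpos : 1 ≤ (N v).card := Finset.card_pos.2 ⟨v, by simp [hN]⟩
  have hP : 0 < s ^ S.card := by positivity
  by_cases h3 : (N v).card = 3
  · have hcd : (S.filter (G.Adj v)).card = 2 := by
      have : (N v).card = (S.filter (G.Adj v)).card + 1 :=
        Finset.card_insert_of_notMem (by simp)
      omega
    obtain ⟨u, w, huw, hUW⟩ := Finset.card_eq_two.1 hcd
    have hu : u ∈ S ∧ G.Adj v u := by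
      have : u ∈ S.filter (G.Adj v) := by rw [hUW]; simp
      simpa using this
    have hw : w ∈ S ∧ G.Adj v w := by
      have : w ∈ S.filter (G.Adj v) := by rw [hUW]; simp
      simpa using this
    have hNv : N v = {v, u, w} := by simp only [hN, hUW]
    -- the asymmetric case
    have asym : ∀ u w : α, u ∈ S → w ∈ S → G.Adj v u → G.Adj v w → u ≠ w → N v = {v, u, w} →
        (N u).card = 3 → ((misFamily G S).card : ℝ) ≤ s ^ S.card := by
      intro u w hu hw hvu hvw huw hNv hu3
      have hcd : ((S.filter (G.Adj u)).erase v).card = 1 := by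
        have h1 : (N u).card = (S.filter (G.Adj u)).card + 1 :=
          Finset.card_insert_of_notMem (by simp)
        have h2 : v ∈ S.filter (G.Adj u) := by simp [hv, hvu.symm]
        rw [Finset.card_erase_of_mem h2]
        omega
      obtain ⟨u', hu'⟩ := Finset.card_eq_one.1 hcd
      have hu'1 : u' ≠ v ∧ u' ∈ S ∧ G.Adj u u' := by
        have : u' ∈ (S.filter (G.Adj u)).erase v := by rw [hu']; simp
        simpa using this
      have hNu : ∀ x ∈ N u, x = u ∨ x = v ∨ x = u' := by
        intro x hx
        simp only [hN, Finset.mem_insert] at hx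
        rcases hx with h | h
        · exact Or.inl h
        · by_cases hxv : x = v
          · exact Or.inr (Or.inl hxv)
          · have : x ∈ (S.filter (G.Adj u)).erase v := Finset.mem_erase.2 ⟨hxv, h⟩
            rw [hu'] at this
            exact Or.inr (Or.inr (by simpa using this))
      have hu'w : u' ≠ w := by
        rintro rfl
        exact hG v u u' hvu hu'1.2.2 hvw
      have hsub : misFamily G S ⊆ (misFamily G S).filter (fun I => {v} ⊆ I) ∪
          (misFamily G S).filter (fun I => {u} ⊆ I) ∪
          (misFamily G S).filter (fun I => {w, u'} ⊆ I) := by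
        intro I hI
        obtain ⟨a, ha, haI⟩ := hcov v hv I hI
        obtain ⟨b, hb, hbI⟩ := hcov u hu I hI
        have hb' := hNu b hb
        rw [hNv] at ha
        simp only [Finset.mem_union, Finset.mem_filter, Finset.singleton_subset_iff,
          Finset.insert_subset_iff, hI, true_and]
        simp only [Finset.mem_insert, Finset.mem_singleton] at ha
        grind
      have hc := (Finset.card_le_card hsub).trans ((Finset.card_union_le _ _).trans
        (Nat.add_le_add_right (Finset.card_union_le _ _) _))
      have hc' : ((misFamily G S).card : ℝ) ≤
          (((misFamily G S).filter (fun I => {v} ⊆ I)).card : ℝ) +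
          (((misFamily G S).filter (fun I => {u} ⊆ I)).card : ℝ) +
          (((misFamily G S).filter (fun I => {w, u'} ⊆ I)).card : ℝ) := by exact_mod_cast hc
      have b1 := hbr1 v hv 3 (by norm_num) (by omega)
      have b2 := hbr1 u hu 3 (by norm_num) (by omega)
      have b3 := hbr {w, u'} {v, u, w, u'} 4 (by norm_num) (by
          have e1 := hvu.ne
          have e2 := hvw.ne
          have e3 := hu'1.2.2.ne
          have e4 := hu'1.1
          rw [Finset.card_insert_of_notMem, Finset.card_insert_of_notMem,
            Finset.card_pair hu'w.symm] <;> simp <;> tauto) (by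
          intro x hx
          simp only [Finset.mem_insert, Finset.mem_singleton] at hx
          rcases hx with rfl | rfl | rfl | rfl
          exacts [hv, hu, hw, hu'1.2.1]) (by
          intro x hx
          simp only [Finset.mem_insert, Finset.mem_singleton] at hx ⊢
          rcases hx with rfl | rfl | rfl | rfl
          · exact Or.inr ⟨w, Or.inl rfl, hvw.symm⟩
          · exact Or.inr ⟨u', Or.inr rfl, hu'1.2.2.symm⟩
          · tauto
          · tauto)
      have e3 : s ^ 3 = 2 * s := by rw [pow_succ, hs2]
      have e4 : s ^ 4 = 4 := by rw [show 4 = 2 * 2 from rfl, pow_mul, hs2]; norm_num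
      have f3 : s ^ S.card / s ^ 3 = s ^ S.card * (s / 4) := by
        rw [e3]; field_simp; rw [hs2]; norm_num
      rw [f3] at b1 b2
      rw [e4] at b3
      nlinarith
    by_cases hu3 : (N u).card = 3
    · exact asym u w hu.1 hw.1 hu.2 hw.2 huw hNv hu3
    by_cases hw3 : (N w).card = 3
    · exact asym w u hw.1 hu.1 hw.2 hu.2 huw.symm (by rw [hNv, Finset.pair_comm]) hw3
    have hsub : misFamily G S ⊆ (misFamily G S).filter (fun I => {v} ⊆ I) ∪
        (misFamily G S).filter (fun I => {u} ⊆ I) ∪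
        (misFamily G S).filter (fun I => {w} ⊆ I) := by
      intro I hI
      obtain ⟨a, ha, haI⟩ := hcov v hv I hI
      rw [hNv] at ha
      simp only [Finset.mem_union, Finset.mem_filter, Finset.singleton_subset_iff,
        hI, true_and]
      simp only [Finset.mem_insert, Finset.mem_singleton] at ha
      grind
    have hc := (Finset.card_le_card hsub).trans ((Finset.card_union_le _ _).trans
      (Nat.add_le_add_right (Finset.card_union_le _ _) _))
    have hc' : ((misFamily G S).card : ℝ) ≤
        (((misFamily G S).filter (fun I => {v} ⊆ I)).card : ℝ) +
        (((misFamily G S).filter (fun I => {u} ⊆ I)).card : ℝ) +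
        (((misFamily G S).filter (fun I => {w} ⊆ I)).card : ℝ) := by exact_mod_cast hc
    have b1 := hbr1 v hv 3 (by norm_num) (by omega)
    have b2 := hbr1 u hu.1 4 (by norm_num) (by have := hmin u hu.1; omega)
    have b3 := hbr1 w hw.1 4 (by norm_num) (by have := hmin w hw.1; omega)
    have e3 : s ^ 3 = 2 * s := by rw [pow_succ, hs2]
    have e4 : s ^ 4 = 4 := by rw [show 4 = 2 * 2 from rfl, pow_mul, hs2]; norm_num
    have f3 : s ^ S.card / s ^ 3 = s ^ S.card * (s / 4) := by
      rw [e3]; field_simp; rw [hs2]; norm_num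
    rw [f3] at b1
    rw [e4] at b2 b3
    nlinarith
  · have hsub : misFamily G S ⊆
        (N v).biUnion (fun u => (misFamily G S).filter (fun I => {u} ⊆ I)) := by
      intro I hI
      obtain ⟨a, ha, haI⟩ := hcov v hv I hI
      simp only [Finset.mem_biUnion, Finset.mem_filter, Finset.singleton_subset_iff]
      exact ⟨a, ha, hI, haI⟩
    have hc := (Finset.card_le_card hsub).trans Finset.card_biUnion_le
    calc ((misFamily G S).card : ℝ) ≤
          ∑ u ∈ N v, (((misFamily G S).filter (fun I => {u} ⊆ I)).card : ℝ) := by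
            exact_mod_cast hc
      _ ≤ ∑ u ∈ N v, s ^ S.card / s ^ (N v).card := by
          apply Finset.sum_le_sum
          intro u hu
          exact hbr1 u (hNS v hv hu) _ hpos (hmin u (hNS v hv hu))
      _ = (N v).card * (s ^ S.card / s ^ (N v).card) := by simp
      _ ≤ s ^ (N v).card * (s ^ S.card / s ^ (N v).card) := by
          gcongr
          exact le_sqrt_two_pow _ h3
      _ = s ^ S.card := by field_simp

lemma cliqueFree_three_iff {V : Type*} (G : SimpleGraph V) :
    G.CliqueFree 3 ↔ ∀ x y z, G.Adj x y → G.Adj y z → ¬ G.Adj x z := by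
  classical
  constructor
  · intro h x y z hxy hyz hxz
    exact h {x, y, z} (SimpleGraph.is3Clique_triple_iff.2 ⟨hxy, hxz, hyz⟩)
  · intro h t ht
    obtain ⟨a, b, c, hab, hac, hbc, rfl⟩ := SimpleGraph.is3Clique_iff.1 ht
    exact h a b c hab hbc hac

/-- A non-edge of a maximal triangle-free graph has a common neighbour. -/
lemma MaximalTriangleFree.common {n : ℕ} {H : SimpleGraph (Fin n)} (hH : MaximalTriangleFree H)
    {u v : Fin n} (huv : u ≠ v) (h : ¬ H.Adj u v) : ∃ w, H.Adj u w ∧ H.Adj v w := by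
  have h1 := hH.2 u v huv h
  have h0 := (cliqueFree_three_iff H).1 hH.1
  rw [cliqueFree_three_iff] at h1
  push Not at h1
  obtain ⟨x, y, z, hxy, hyz, hxz⟩ := h1
  simp only [SimpleGraph.sup_adj, SimpleGraph.fromEdgeSet_adj, Set.mem_singleton_iff,
    Sym2.eq_iff] at hxy hyz hxz
  have s1 := H.symm.symm
  by_contra hw
  push Not at hw
  grind

/-- The link graph on the edges of `A` given the graph `B`. -/
def linkGraph {V : Type*} (A B : SimpleGraph V) : SimpleGraph (Sym2 V) where
  Adj e f := ∃ x y z, e = s(x, y) ∧ f = s(x, z) ∧ A.Adj x y ∧ A.Adj x z ∧ B.Adj y z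
  symm.symm := by
    rintro e f ⟨x, y, z, he, hf, h1, h2, h3⟩
    exact ⟨x, z, y, hf, he, h2, h1, h3.symm⟩
  loopless.irrefl := by
    rintro e ⟨x, y, z, he, hf, h1, h2, h3⟩
    rw [he] at hf
    have : y = z := by
      rw [Sym2.eq_iff] at hf
      grind
    exact h3.ne this

lemma linkGraph_triangleFree {V : Type*} (A B : SimpleGraph V)
    (hA : A.CliqueFree 3) (hB : B.CliqueFree 3) :
    ∀ x y z, (linkGraph A B).Adj x y → (linkGraph A B).Adj y z → ¬ (linkGraph A B).Adj x z := by
  rw [cliqueFree_three_iff] at hA hB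
  rintro e f g ⟨x, y, z, he, hf, a1, a2, a3⟩ ⟨x', y', z', hf', hg', b1, b2, b3⟩
    ⟨x'', y'', z'', he'', hg'', c1, c2, c3⟩
  have s1 := A.symm.symm
  have s2 := B.symm.symm
  subst he hf hg'
  rw [Sym2.eq_iff] at hf' he'' hg''
  rcases hf' with ⟨rfl, rfl⟩ | ⟨rfl, rfl⟩ <;> rcases he'' with ⟨rfl, rfl⟩ | ⟨rfl, rfl⟩ <;> grind

open Classical in
/-- Number of maximal triangle-free graphs with a given part outside `A`. -/
lemma count_fixed {n : ℕ} (A B : SimpleGraph (Fin n)) (hA : A.CliqueFree 3) :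
    (((Finset.univ : Finset (SimpleGraph (Fin n))).filter
      (fun H => MaximalTriangleFree H ∧ H \ A = B)).card : ℝ) ≤
      Real.sqrt 2 ^ A.edgeFinset.card := by
  have hs1 : 1 ≤ Real.sqrt 2 := by
    rw [Real.one_le_sqrt]; norm_num
  by_cases hB : B.CliqueFree 3
  swap
  · rw [Finset.filter_false_of_mem]
    · simp
    · rintro H - ⟨hH, rfl⟩
      exact hB (hH.1.mono (by simp) |>.anti sdiff_le)
  set S := A.edgeFinset.filter
    (fun e => ¬ ∃ x y z, e = s(x, y) ∧ B.Adj x z ∧ B.Adj y z) with hS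
  refine le_trans ?_ ((hujter_tuza (linkGraph A B) (linkGraph_triangleFree A B hA hB) S).trans
    (pow_le_pow_right₀ hs1 (Finset.card_le_card (Finset.filter_subset _ _))))
  norm_cast
  refine Finset.card_le_card_of_injOn (fun H => A.edgeFinset.filter (fun e => e ∈ H.edgeSet)) ?_ ?_
  · rintro H hH
    simp only [Finset.coe_filter, Set.mem_ofPred_eq, Finset.mem_univ, true_and] at hH
    obtain ⟨hH, rfl⟩ := hH
    have h0 := (cliqueFree_three_iff H).1 hH.1
    have hA0 := (cliqueFree_three_iff A).1 hA
    rw [Finset.mem_coe, mem_misFamily]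
    refine ⟨?_, ?_, ?_⟩
    · intro e he
      simp only [Finset.mem_filter] at he
      simp only [hS, Finset.mem_filter]
      refine ⟨he.1, ?_⟩
      rintro ⟨x, y, z, rfl, h1, h2⟩
      exact h0 x y z he.2 h2.1 h1.1
    · rintro e he f hf ⟨x, y, z, rfl, rfl, h1, h2, h3⟩
      simp only [Finset.mem_filter, SimpleGraph.mem_edgeSet] at he hf
      exact h0 x y z he.2 h3.1 hf.2
    · intro e he heH
      induction e using Sym2.ind with
      | _ u v =>
      simp only [hS, Finset.mem_filter, SimpleGraph.mem_edgeFinset, SimpleGraph.mem_edgeSet]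
        at he heH
      obtain ⟨heA, heB⟩ := he
      have hnot : ¬ H.Adj u v := fun h => heH ⟨heA, h⟩
      obtain ⟨w, hu, hv⟩ := hH.common heA.ne hnot
      simp only [Finset.mem_filter, SimpleGraph.mem_edgeFinset]
      by_cases hAu : A.Adj u w
      · have hAv : ¬ A.Adj v w := fun h => hA0 u v w heA h hAu
        refine ⟨s(u, w), ⟨hAu, hu⟩, u, v, w, rfl, rfl, heA, hAu, ?_⟩
        exact ⟨hv, hAv⟩
      · by_cases hAv : A.Adj v w
        · refine ⟨s(v, w), ⟨hAv, hv⟩, v, u, w, Sym2.eq_swap, rfl, heA.symm, hAv, ?_⟩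
          exact ⟨hu, hAu⟩
        · exact absurd ⟨u, v, w, rfl, ⟨hu, hAu⟩, ⟨hv, hAv⟩⟩ heB
  · intro H hH K hK h
    simp only [Finset.coe_filter, Set.mem_ofPred_eq, Finset.mem_univ, true_and] at hH hK
    ext u v
    have h1 : (H \ A).Adj u v ↔ (K \ A).Adj u v := by rw [hH.2, hK.2]
    have h2 := Finset.ext_iff.1 h s(u, v)
    simp only [Finset.mem_filter, SimpleGraph.mem_edgeFinset, SimpleGraph.mem_edgeSet,
      SimpleGraph.sdiff_adj] at h1 h2
    tauto

open Classical in
lemma count_few_sets (ε : ℝ) (hε : 0 < ε) : ∃ δ : ℝ, 0 < δ ∧ δ ≤ 1 ∧ ∀ n : ℕ,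
    (((Finset.univ : Finset (SimpleGraph (Fin n))).filter
      (fun B => (B.edgeFinset.card : ℝ) ≤ δ * (n : ℝ) ^ 2)).card : ℝ) ≤
      2 ^ (ε * (n : ℝ) ^ 2) := by
  set η : ℝ := min (1 / 2) (ε / 4) with hη
  have hη0 : 0 < η := by positivity
  have hη1 : η ≤ 1 / 2 := min_le_left _ _
  have hηε : η ≤ ε / 4 := min_le_right _ _
  set l : ℝ := Real.log (1 / η) with hl
  have hl0 : 0 < l := Real.log_pos (by rw [lt_div_iff₀ hη0]; linarith)
  have hlog : Real.log η = - l := by rw [hl, one_div, Real.log_inv]; ring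
  have hlog2 : (1 : ℝ) / 2 < Real.log 2 := by have := Real.log_two_gt_d9; linarith
  refine ⟨min 1 (ε / 4 / l), by positivity, min_le_left _ _, fun n => ?_⟩
  set δ := min 1 (ε / 4 / l) with hδ
  have hδl : δ * l ≤ ε / 4 := by
    rw [← le_div_iff₀ hl0]; exact min_le_right _ _
  set F : Finset (Finset (Sym2 (Fin n))) :=
    Finset.univ.filter (fun s => (s.card : ℝ) ≤ δ * (n : ℝ) ^ 2) with hF
  have h1 : ((Finset.univ : Finset (SimpleGraph (Fin n))).filter
      (fun B => (B.edgeFinset.card : ℝ) ≤ δ * (n : ℝ) ^ 2)).card ≤ F.card := by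
    refine Finset.card_le_card_of_injOn (fun B => B.edgeFinset) ?_ ?_
    · intro B hB
      simpa [hF] using hB
    · intro B _ C _ h
      exact SimpleGraph.edgeFinset_inj.1 h
  have h2 : (F.card : ℝ) * η ^ (δ * (n : ℝ) ^ 2) ≤ (1 + η) ^ (Fintype.card (Sym2 (Fin n))) := by
    calc (F.card : ℝ) * η ^ (δ * (n : ℝ) ^ 2) = ∑ s ∈ F, η ^ (δ * (n : ℝ) ^ 2) := by simp
      _ ≤ ∑ s ∈ F, η ^ s.card := by
          apply Finset.sum_le_sum
          intro s hs
          rw [← Real.rpow_natCast η s.card]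
          apply Real.rpow_le_rpow_of_exponent_ge hη0 (by linarith)
          simpa [hF] using hs
      _ ≤ ∑ s : Finset (Sym2 (Fin n)), η ^ s.card :=
          Finset.sum_le_sum_of_subset_of_nonneg (Finset.subset_univ _)
            (fun _ _ _ => by positivity)
      _ = (1 + η) ^ (Fintype.card (Sym2 (Fin n))) := by
          have := Fintype.sum_pow_mul_eq_add_pow (Sym2 (Fin n)) η 1
          rw [add_comm, ← this]
          simp
  have hcard : ((Fintype.card (Sym2 (Fin n)) : ℕ) : ℝ) ≤ (n : ℝ) ^ 2 := by
    rw [Sym2.card, Fintype.card_fin]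
    have : (n + 1).choose 2 ≤ n ^ 2 := by
      rw [Nat.choose_two_right]
      apply Nat.div_le_of_le_mul
      simp
      nlinarith [Nat.le_self_pow (two_ne_zero) n]
    exact_mod_cast this
  have h3 : (1 + η) ^ (Fintype.card (Sym2 (Fin n))) ≤ Real.exp (η * (n : ℝ) ^ 2) := by
    calc (1 + η) ^ (Fintype.card (Sym2 (Fin n))) ≤ (Real.exp η) ^ (Fintype.card (Sym2 (Fin n))) := by
          gcongr
          linarith [Real.add_one_le_exp η]
      _ = Real.exp ((Fintype.card (Sym2 (Fin n)) : ℕ) * η) := by rw [Real.exp_nat_mul]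
      _ ≤ _ := by
          apply Real.exp_le_exp.2
          nlinarith
  have h4 : η ^ (δ * (n : ℝ) ^ 2) = Real.exp (- (δ * l * (n : ℝ) ^ 2)) := by
    rw [Real.rpow_def_of_pos hη0, hlog]; congr 1; ring
  rw [h4, Real.exp_neg, ← div_eq_mul_inv, div_le_iff₀ (Real.exp_pos _)] at h2
  calc _ ≤ (F.card : ℝ) := by exact_mod_cast h1
    _ ≤ _ := h2
    _ ≤ Real.exp (η * (n : ℝ) ^ 2) * Real.exp (δ * l * (n : ℝ) ^ 2) := by gcongr
    _ = Real.exp ((η + δ * l) * (n : ℝ) ^ 2) := by rw [← Real.exp_add]; congr 1; ring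
    _ ≤ Real.exp (Real.log 2 * (ε * (n : ℝ) ^ 2)) := by
        apply Real.exp_le_exp.2
        rw [← mul_assoc]
        gcongr
        nlinarith
    _ = _ := by rw [Real.rpow_def_of_pos (by norm_num)]

/-- The graph coded by a colouring and a relation on the colours. -/
def decodeGraph {n M : ℕ} (p : (Fin n → Fin M) × (Fin M → Fin M → Prop)) :
    SimpleGraph (Fin n) where
  Adj u v := u ≠ v ∧ p.2 (p.1 u) (p.1 v) ∧ p.2 (p.1 v) (p.1 u)
  symm.symm := fun _ _ h => ⟨h.1.symm, h.2.2, h.2.1⟩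
  loopless.irrefl := fun _ h => h.1 rfl

open Classical in
/-- Regularity: a triangle-free graph is almost contained in a triangle-free graph of bounded
complexity. -/
lemma exists_approx (δ : ℝ) (hδ : 0 < δ) (hδ1 : δ ≤ 1) : ∃ M N : ℕ, 0 < M ∧ ∀ n : ℕ, N ≤ n →
    ∀ H : SimpleGraph (Fin n), H.CliqueFree 3 →
    ∃ p : (Fin n → Fin M) × (Fin M → Fin M → Prop), (decodeGraph p).CliqueFree 3 ∧
      ((H \ decodeGraph p).edgeFinset.card : ℝ) ≤ δ * (n : ℝ) ^ 2 := by
  set l : ℕ := ⌈4 / δ⌉₊ with hl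
  set M : ℕ := SzemerediRegularity.bound (δ / 8) l with hM
  refine ⟨M, l + 1, SzemerediRegularity.bound_pos _ _, fun n hn H hH => ?_⟩
  have : Nonempty (Fin n) := ⟨⟨0, by omega⟩⟩
  obtain ⟨P, hP₁, hP₂, hP₃, hP₄⟩ := szemeredi_regularity H (by positivity : 0 < δ / 8)
    (show l ≤ Fintype.card (Fin n) by simp; omega)
  have hcard : 4 / δ ≤ P.parts.card := (Nat.le_ceil _).trans (Nat.cast_le.2 hP₂)
  have k := SimpleGraph.regularityReduced_edges_card_aux hδ hP₁ hP₄ hcard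
  let Q : Finset (Fin n) → Finset (Fin n) → Prop := fun U V =>
    U ≠ V ∧ H.IsUniform (δ / 8) U V ∧ δ / 4 ≤ H.edgeDensity U V
  let e : P.parts ↪ Fin M := P.parts.equivFin.toEmbedding.trans (Fin.castLEEmb hP₃)
  have hpart : ∀ u, P.part u ∈ P.parts := fun u => P.part_mem.2 (Finset.mem_univ u)
  let c : Fin n → Fin M := fun u => e ⟨P.part u, hpart u⟩
  let R : Fin M → Fin M → Prop := fun i j => ∃ u v, c u = i ∧ c v = j ∧ Q (P.part u) (P.part v)
  have hR : ∀ u v, R (c u) (c v) ↔ Q (P.part u) (P.part v) := by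
    intro u v
    constructor
    · rintro ⟨u', v', hu, hv, h⟩
      have h1 := congrArg Subtype.val (e.injective hu)
      have h2 := congrArg Subtype.val (e.injective hv)
      simp only at h1 h2
      rwa [h1, h2] at h
    · intro h
      exact ⟨u, v, rfl, rfl, h⟩
  have hQs : ∀ U V, Q U V → Q V U := by
    rintro U V ⟨h1, h2, h3⟩
    exact ⟨h1.symm, h2.symm, by rwa [SimpleGraph.edgeDensity_comm]⟩
  have hadj : ∀ u v, (decodeGraph (c, R)).Adj u v ↔ Q (P.part u) (P.part v) := by
    intro u v
    simp only [decodeGraph, hR]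
    constructor
    · exact fun h => h.2.1
    · exact fun h => ⟨fun huv => h.1 (by rw [huv]), h, hQs _ _ h⟩
  refine ⟨(c, R), ?_, ?_⟩
  · rw [cliqueFree_three_iff]
    intro x y z hxy hyz hxz
    rw [hadj] at hxy hyz hxz
    have t := H.triangle_counting' (ε := δ / 8) (s := P.part x) (t := P.part y) (u := P.part z)
      (by linarith [hxy.2.2]) hxy.2.1 (by linarith [hxz.2.2]) hxz.2.1
      (by linarith [hyz.2.2]) hyz.2.1
    have hpos : ∀ u, (0 : ℝ) < (P.part u).card := fun u => by
      exact_mod_cast Finset.card_pos.2 (P.nonempty_of_mem_parts (hpart u))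
    have h1 := hpos x
    have h2 := hpos y
    have h3 := hpos z
    have h4 : 0 < 1 - 2 * (δ / 8) := by linarith
    have hlt := lt_of_lt_of_le (by positivity) t
    obtain ⟨⟨a, b, c⟩, habc⟩ := Finset.card_pos.1 (Nat.cast_pos.1 hlt)
    simp only [Finset.mem_filter] at habc
    exact (cliqueFree_three_iff H).1 hH a b c habc.2.1 habc.2.2.2 habc.2.2.1
  · set H' := H.regularityReduced P (δ / 8) (δ / 4) with hH'
    have hsub : (H \ decodeGraph (c, R)).edgeFinset ⊆ H.edgeFinset \ H'.edgeFinset := by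
      intro f hf
      induction f using Sym2.ind with
      | _ u v =>
      simp only [SimpleGraph.mem_edgeFinset, SimpleGraph.mem_edgeSet, SimpleGraph.sdiff_adj,
        hadj, Finset.mem_sdiff] at hf ⊢
      refine ⟨hf.1, fun h => hf.2 ?_⟩
      obtain ⟨-, U, hU, V, hV, huU, hvV, hne, hun, hd⟩ := h
      rw [P.part_eq_of_mem hU huU, P.part_eq_of_mem hV hvV]
      exact ⟨hne, hun, hd⟩
    have hsub' : H'.edgeFinset ⊆ H.edgeFinset :=
      SimpleGraph.edgeFinset_mono SimpleGraph.regularityReduced_le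
    have hc := Finset.card_le_card hsub
    have hc2 := Finset.card_sdiff_add_card_eq_card hsub'
    have hc3 : ((H \ decodeGraph (c, R)).edgeFinset.card : ℝ) + H'.edgeFinset.card ≤
      H.edgeFinset.card := by exact_mod_cast (by omega)
    simp only [Fintype.card_fin, Nat.cast_pow] at k
    have k2 : (2 : ℝ) * (H.edgeFinset.card - H'.edgeFinset.card) < 2 * δ * (n : ℝ) ^ 2 := by
      convert k using 4
    linarith

/-- The number of maximal triangle-free graphs on vertex set `Fin n` is at most
`2 ^ (n^2/8 + o(n^2))`. -/
theorem maximal_triangle_free_upper_bound :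
    ∀ ε : ℝ, 0 < ε → ∃ N : ℕ, ∀ n : ℕ, N ≤ n →
      (Nat.card {H : SimpleGraph (Fin n) // MaximalTriangleFree H} : ℝ)
        ≤ 2 ^ ((1 / 8 + ε) * (n : ℝ) ^ 2) := by
  classical
  intro ε hε
  obtain ⟨δ, hδ, hδ1, hfew⟩ := count_few_sets (ε / 2) (by positivity)
  obtain ⟨M, N, hM, happ⟩ := exists_approx δ hδ hδ1
  refine ⟨max (N + 1) ⌈(2 / ε) * (M + M ^ 2 : ℝ)⌉₊, fun n hn => ?_⟩
  have hnN : N + 1 ≤ n := (le_max_left _ _).trans hn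
  have hn2 : (2 / ε) * (M + M ^ 2 : ℝ) ≤ n :=
    (Nat.le_ceil _).trans (by exact_mod_cast (le_max_right _ _).trans hn)
  have hn1 : (1 : ℝ) ≤ n := by exact_mod_cast (by omega : 1 ≤ n)
  set X : Finset ((Fin n → Fin M) × (Fin M → Fin M → Prop)) :=
    Finset.univ.filter (fun p => (decodeGraph p).CliqueFree 3) with hX
  set Y : Finset (SimpleGraph (Fin n)) := Finset.univ.filter
      (fun B => (B.edgeFinset.card : ℝ) ≤ δ * (n : ℝ) ^ 2) with hY
  set Z : Finset (SimpleGraph (Fin n)) := Finset.univ.filter MaximalTriangleFree with hZ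
  have hcardZ : Nat.card {H : SimpleGraph (Fin n) // MaximalTriangleFree H} = Z.card := by
    rw [Nat.card_eq_fintype_card, Fintype.card_subtype]
  have hsub : Z ⊆ (X ×ˢ Y).biUnion (fun q => Finset.univ.filter
      (fun H => MaximalTriangleFree H ∧ H \ decodeGraph q.1 = q.2)) := by
    intro H hH
    simp only [hZ, Finset.mem_filter, Finset.mem_univ, true_and] at hH
    obtain ⟨p, hp1, hp2⟩ := happ n (by omega) H hH.1
    simp only [Finset.mem_biUnion, Finset.mem_product, Finset.mem_filter, Finset.mem_univ,
      true_and, hX, hY]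
    refine ⟨(p, H \ decodeGraph p), ⟨hp1, ?_⟩, hH, rfl⟩
    convert hp2
  have hbound : ∀ q ∈ X ×ˢ Y, (((Finset.univ : Finset (SimpleGraph (Fin n))).filter
      (fun H => MaximalTriangleFree H ∧ H \ decodeGraph q.1 = q.2)).card : ℝ) ≤
      2 ^ ((1 / 8) * (n : ℝ) ^ 2) := by
    intro q hq
    simp only [Finset.mem_product, hX, Finset.mem_filter, Finset.mem_univ, true_and] at hq
    refine (count_fixed (decodeGraph q.1) q.2 hq.1).trans ?_
    have hturan : (decodeGraph q.1).edgeFinset.card * 4 ≤ n ^ 2 := by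
      have h := SimpleGraph.CliqueFree.card_edgeFinset_le (r := 2) hq.1
      have h' : (decodeGraph q.1).edgeFinset.card ≤
          (n ^ 2 - (n % 2) ^ 2) * (2 - 1) / (2 * 2) + (n % 2).choose 2 := by
        simpa using h
      have h0 : (n % 2).choose 2 = 0 := Nat.choose_eq_zero_of_lt (Nat.mod_lt _ (by norm_num))
      rw [h0] at h'
      omega
    have hturan' : ((decodeGraph q.1).edgeFinset.card : ℝ) * 4 ≤ (n : ℝ) ^ 2 := by
      exact_mod_cast hturan
    rw [← Real.rpow_natCast, Real.sqrt_eq_rpow, ← Real.rpow_mul (by norm_num)]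
    apply Real.rpow_le_rpow_of_exponent_le (by norm_num)
    linarith
  have hXc : (X.card : ℝ) ≤ 2 ^ ((ε / 2) * (n : ℝ) ^ 2) := by
    have h1 : X.card ≤ M ^ n * (2 ^ M) ^ M := by
      refine (Finset.card_filter_le _ _).trans ?_
      simp
    have h2 : M ^ n * (2 ^ M) ^ M ≤ 2 ^ (M * n + M * M) := by
      rw [pow_add, pow_mul, pow_mul]
      gcongr
      exact Nat.lt_two_pow_self.le
    calc (X.card : ℝ) ≤ (2 : ℝ) ^ (M * n + M * M) := by exact_mod_cast h1.trans h2
      _ = (2 : ℝ) ^ ((M * n + M * M : ℝ)) := by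
        rw [← Real.rpow_natCast]; push_cast; rfl
      _ ≤ _ := by
        apply Real.rpow_le_rpow_of_exponent_le (by norm_num)
        have h3 : (M + M ^ 2 : ℝ) ≤ ε / 2 * n := by
          have := mul_le_mul_of_nonneg_left hn2 (by positivity : 0 ≤ ε / 2)
          calc (M + M ^ 2 : ℝ) = ε / 2 * (2 / ε * (M + M ^ 2)) := by field_simp
            _ ≤ _ := this
        nlinarith [mul_le_mul_of_nonneg_right h3 (by positivity : (0 : ℝ) ≤ n),
          mul_le_mul_of_nonneg_left hn1 (by positivity : (0 : ℝ) ≤ (M : ℝ) ^ 2)]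
  have hYc : (Y.card : ℝ) ≤ 2 ^ ((ε / 2) * (n : ℝ) ^ 2) := by
    convert hfew n
  rw [hcardZ]
  have hc := (Finset.card_le_card hsub).trans Finset.card_biUnion_le
  calc (Z.card : ℝ) ≤ ∑ q ∈ X ×ˢ Y, (((Finset.univ : Finset (SimpleGraph (Fin n))).filter
      (fun H => MaximalTriangleFree H ∧ H \ decodeGraph q.1 = q.2)).card : ℝ) := by
        exact_mod_cast hc
    _ ≤ ∑ q ∈ X ×ˢ Y, (2 : ℝ) ^ ((1 / 8) * (n : ℝ) ^ 2) := Finset.sum_le_sum hbound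
    _ = X.card * Y.card * (2 : ℝ) ^ ((1 / 8) * (n : ℝ) ^ 2) := by
        simp [Finset.card_product]
    _ ≤ 2 ^ ((ε / 2) * (n : ℝ) ^ 2) * 2 ^ ((ε / 2) * (n : ℝ) ^ 2) *
        (2 : ℝ) ^ ((1 / 8) * (n : ℝ) ^ 2) := by gcongr
    _ = _ := by
        rw [← Real.rpow_add (by norm_num), ← Real.rpow_add (by norm_num)]
        congr 1; ring
end

section
/- (Container corollary of Balogh–Morris–Samotij / Saxton–Thomason.) For every δ > 0 there exists a constant C > 0 and an N such that for every n ≥ N there is a family {G_1, ..., G_t} of graphs on the vertex set Fin n with t ≤ 2^{C (log n) n^{3/2}}, such that each G_i contains at most δ n^3 triangles (i.e., at most δ n^3 triples of pairwise adjacent vertices), and for every triangle-free graph H on Fin n there exists i ∈ {1,...,t} with H a subgraph of G_i (every edge of H is an edge of G_i). -/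
/-- The number of triangles of `G`: the number of 3-element vertex subsets that are
pairwise adjacent in `G`. -/
noncomputable def triangleCount {V : Type*} (G : SimpleGraph V) : ℕ :=
  Nat.card {s : Finset V // G.IsNClique 3 s}

namespace ContainerAux

open Classical in
/-- pair-degree of `u` : neighbours `w` in `A` completing a triple with a selected vertex -/
noncomputable def d2 {V : Type*} (R : V → V → V → Prop) (S A : Finset V) (u : V) : ℕ :=
  (A.filter (fun w => ∃ s ∈ S, R s u w)).card

open Classical in
/-- number of (ordered) pairs of `A` completing a triple with a selected vertex -/
noncomputable def ee {V : Type*} (R : V → V → V → Prop) (S A : Finset V) : ℕ :=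
  ((A ×ˢ A).filter (fun p => ∃ s ∈ S, R s p.1 p.2)).card

open Classical in
/-- degree of `v` in `A` (ordered pairs) -/
noncomputable def d1 {V : Type*} (R : V → V → V → Prop) (A : Finset V) (v : V) : ℕ :=
  ((A ×ˢ A).filter (fun p => R v p.1 p.2)).card

theorem card_prod_filter {V : Type*} (X Y : Finset V) (g : V → V → Prop)
    [DecidablePred (fun p : V × V => g p.1 p.2)] [∀ x, DecidablePred (fun y => g x y)] :
    ((X ×ˢ Y).filter (fun p => g p.1 p.2)).card
      = ∑ x ∈ X, (Y.filter (fun y => g x y)).card := by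
  rw [Finset.card_filter, Finset.sum_product]
  refine Finset.sum_congr rfl fun x _ => ?_
  rw [Finset.card_filter]

theorem ee_le {V : Type*} (R : V → V → V → Prop) (S A : Finset V) (k : ℕ)
    (h : ∀ u ∈ A, d2 R S A u ≤ k) : ee R S A ≤ A.card * k := by
  classical
  unfold ee
  rw [card_prod_filter A A (fun u w => ∃ s ∈ S, R s u w)]
  have := Finset.sum_le_card_nsmul A (fun u => d2 R S A u) k h
  simpa [d2] using this

open Classical in
theorem ee_sdiff {V : Type*} (R : V → V → V → Prop) (h2 : ∀ a b c, R a b c → R a c b)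
    (S A B : Finset V) (hB : B ⊆ A) (k : ℕ) (h : ∀ u ∈ A, d2 R S A u ≤ k) :
    ee R S A ≤ ee R S (A \ B) + 2 * (k * B.card) := by
  have hBk : ((B ×ˢ A).filter (fun p => ∃ s ∈ S, R s p.1 p.2)).card ≤ k * B.card := by
    rw [card_prod_filter B A (fun u w => ∃ s ∈ S, R s u w)]
    have := Finset.sum_le_card_nsmul B (fun u => d2 R S A u) k (fun u hu => h u (hB hu))
    rw [mul_comm]
    simpa [d2] using this
  have hsub : (A ×ˢ A).filter (fun p => ∃ s ∈ S, R s p.1 p.2) ⊆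
      ((A \ B) ×ˢ (A \ B)).filter (fun p => ∃ s ∈ S, R s p.1 p.2) ∪
      ((B ×ˢ A).filter (fun p => ∃ s ∈ S, R s p.1 p.2) ∪
       ((B ×ˢ A).filter (fun p => ∃ s ∈ S, R s p.1 p.2)).image Prod.swap) := by
    rintro ⟨u, w⟩ hp
    simp only [Finset.mem_filter, Finset.mem_product] at hp
    obtain ⟨⟨hu, hw⟩, s, hs, hR⟩ := hp
    simp only [Finset.mem_union, Finset.mem_filter, Finset.mem_product, Finset.mem_sdiff,
      Finset.mem_image]
    by_cases huB : u ∈ B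
    · exact Or.inr (Or.inl ⟨⟨huB, hw⟩, s, hs, hR⟩)
    by_cases hwB : w ∈ B
    · exact Or.inr (Or.inr ⟨(w, u), ⟨⟨hwB, hu⟩, s, hs, h2 _ _ _ hR⟩, rfl⟩)
    · exact Or.inl ⟨⟨⟨hu, huB⟩, ⟨hw, hwB⟩⟩, s, hs, hR⟩
  have c1 := Finset.card_le_card hsub
  have c2 := Finset.card_union_le
    (((A \ B) ×ˢ (A \ B)).filter (fun p => ∃ s ∈ S, R s p.1 p.2))
    ((B ×ˢ A).filter (fun p => ∃ s ∈ S, R s p.1 p.2) ∪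
       ((B ×ˢ A).filter (fun p => ∃ s ∈ S, R s p.1 p.2)).image Prod.swap)
  have c3 := Finset.card_union_le
    ((B ×ˢ A).filter (fun p => ∃ s ∈ S, R s p.1 p.2))
    (((B ×ˢ A).filter (fun p => ∃ s ∈ S, R s p.1 p.2)).image Prod.swap)
  have c4 := Finset.card_image_le (s := (B ×ˢ A).filter (fun p => ∃ s ∈ S, R s p.1 p.2))
    (f := Prod.swap)
  unfold ee
  omega

theorem d2_mono {V : Type*} (R : V → V → V → Prop) (S A A' : Finset V) (hA : A' ⊆ A) (u : V) :
    d2 R S A' u ≤ d2 R S A u := by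
  classical
  exact Finset.card_le_card (Finset.filter_subset_filter _ hA)

open Classical in
theorem d2_insert {V : Type*} (R : V → V → V → Prop)
    (hu : ∀ a b c c', R a b c → R a b c' → c = c') (S A : Finset V) (v u : V) :
    d2 R (insert v S) A u ≤ d2 R S A u + 1 := by
  unfold d2
  have hsub : A.filter (fun w => ∃ s ∈ insert v S, R s u w) ⊆
      A.filter (fun w => ∃ s ∈ S, R s u w) ∪ A.filter (fun w => R v u w) := by
    intro w hw
    simp only [Finset.mem_filter, Finset.mem_insert, Finset.mem_union] at hw ⊢
    obtain ⟨hw, s, rfl | hs, hR⟩ := hw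
    · exact Or.inr ⟨hw, hR⟩
    · exact Or.inl ⟨hw, s, hs, hR⟩
  have h1 : (A.filter (fun w => R v u w)).card ≤ 1 := by
    rw [Finset.card_le_one]
    intro a ha b hb
    exact hu _ _ _ _ (Finset.mem_filter.1 ha).2 (Finset.mem_filter.1 hb).2
  have c1 := Finset.card_le_card hsub
  have c2 := Finset.card_union_le (A.filter (fun w => ∃ s ∈ S, R s u w))
    (A.filter (fun w => R v u w))
  omega

open Classical in
theorem ee_insert {V : Type*} (R : V → V → V → Prop)
    (h1 : ∀ a b c, R a b c → R b a c) (h2 : ∀ a b c, R a b c → R a c b)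
    (hne : ∀ a b c, R a b c → a ≠ b)
    (hu : ∀ a b c c', R a b c → R a b c' → c = c') (S A : Finset V) (v : V) (hv : v ∉ S) :
    ee R S (A \ {v}) + d1 R A v ≤ ee R (insert v S) (A \ {v}) := by
  unfold ee d1
  rw [← Finset.card_union_of_disjoint]
  · apply Finset.card_le_card
    rintro ⟨a, b⟩ hp
    simp only [Finset.mem_filter, Finset.mem_insert, Finset.mem_union, Finset.mem_product,
      Finset.mem_sdiff, Finset.mem_singleton] at hp ⊢
    rcases hp with ⟨hp, s, hs, hR⟩ | ⟨⟨ha, hb⟩, hR⟩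
    · exact ⟨hp, s, Or.inr hs, hR⟩
    · exact ⟨⟨⟨ha, (hne _ _ _ hR).symm⟩, ⟨hb, (hne _ _ _ (h2 _ _ _ hR)).symm⟩⟩,
        v, Or.inl rfl, hR⟩
  · rw [Finset.disjoint_left]
    rintro ⟨a, b⟩ hp hq
    simp only [Finset.mem_filter] at hp hq
    obtain ⟨_, s, hs, hR⟩ := hp
    have e : s = v := hu a b s v (h2 _ _ _ (h1 _ _ _ hR))
      (h2 _ _ _ (h1 _ _ _ hq.2))
    exact hv (e ▸ hs)

open Classical in
theorem cov {V : Type*} (R : V → V → V → Prop)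
    (h1 : ∀ a b c, R a b c → R b a c) (h2 : ∀ a b c, R a b c → R a c b)
    (hne : ∀ a b c, R a b c → a ≠ b)
    (hu : ∀ a b c c', R a b c → R a b c' → c = c')
    (k D Q : ℕ) (hk : 1 ≤ k) (hD : D ≤ k * (k + 1)) :
    ∀ (m q : ℕ) (A F S : Finset V), A.card ≤ m → Disjoint S A →
      (∀ u ∈ A, d2 R S A u ≤ k) → 3 * (k * A.card) ≤ ee R S A + q * D → F.card + q ≤ Q →
      ∃ T : Finset (Finset V), T.card ≤ (m + 1) ^ q ∧
        (∀ C ∈ T, ∃ A' F' : Finset V, C = A' ∪ F' ∧ F'.card ≤ Q ∧ ∀ v ∈ A', d1 R A' v < D) ∧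
        ∀ I : Set V, (∀ a ∈ I, ∀ b ∈ I, ∀ c ∈ I, ¬ R a b c) → (∀ s ∈ S, s ∈ I) →
          (∀ x ∈ I, x ∈ A ∪ F) → ∃ C ∈ T, ∀ x ∈ I, x ∈ C := by
  intro m
  induction m with
  | zero =>
    intro q A F S hA hdis hd hpot hF
    have : A = ∅ := by simpa using hA
    subst this
    refine ⟨{∅ ∪ F}, by simp, ?_, ?_⟩
    · intro C hC
      exact ⟨∅, F, by simpa using hC, by omega, by simp⟩
    · intro I _ _ hI
      exact ⟨_, Finset.mem_singleton_self _, hI⟩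
  | succ m ih =>
    intro q A F S hA hdis hd hpot hF
    -- terminal case
    by_cases hterm : ∀ v ∈ A, d1 R A v < D
    · refine ⟨{A ∪ F}, by simpa using Nat.one_le_pow _ _ (by omega), ?_, ?_⟩
      · intro C hC
        exact ⟨A, F, by simpa using hC, by omega, hterm⟩
      · intro I _ _ hI
        exact ⟨_, Finset.mem_singleton_self _, hI⟩
    push Not at hterm
    obtain ⟨v0, hv0, hv0D⟩ := hterm
    have hApos : 1 ≤ A.card := Finset.card_pos.2 ⟨v0, hv0⟩
    have hee := ee_le R S A k hd
    have hq : 1 ≤ q := by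
      by_contra hq
      have : q = 0 := by omega
      subst this
      have : 1 ≤ k * A.card := Nat.mul_pos hk hApos
      rw [mul_comm] at hee
      omega
    obtain ⟨q, rfl⟩ : ∃ q', q = q' + 1 := ⟨q - 1, by omega⟩
    -- removing
    have hrem : ∀ B ⊆ A, 3 * (k * (A \ B).card) + k * B.card ≤ ee R S (A \ B) + (q + 1) * D := by
      intro B hB
      have e := ee_sdiff R h2 S A B hB k hd
      have c := Finset.card_sdiff_add_card_eq_card hB
      have c' : k * (A \ B).card + k * B.card = k * A.card := by rw [← mul_add, c]
      omega
    -- combine the branches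
    suffices hyes : ∃ v ∈ A, ∃ T : Finset (Finset V), T.card ≤ (m + 1) ^ q ∧
        (∀ C ∈ T, ∃ A' F' : Finset V, C = A' ∪ F' ∧ F'.card ≤ Q ∧ ∀ v ∈ A', d1 R A' v < D) ∧
        ∀ I : Set V, (∀ a ∈ I, ∀ b ∈ I, ∀ c ∈ I, ¬ R a b c) → (∀ s ∈ S, s ∈ I) →
          (∀ x ∈ I, x ∈ A ∪ F) → v ∈ I → ∃ C ∈ T, ∀ x ∈ I, x ∈ C by
      obtain ⟨v, hv, T1, hT1, hT1', hT1''⟩ := hyes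
      have hvc := Finset.card_sdiff_add_card_eq_card (Finset.singleton_subset_iff.2 hv)
      rw [Finset.card_singleton] at hvc
      obtain ⟨T2, hT2, hT2', hT2''⟩ := ih (q + 1) (A \ {v}) F S (by omega)
        (hdis.mono_right Finset.sdiff_subset)
        (fun u hu' => (d2_mono R S A _ Finset.sdiff_subset u).trans
          (hd u (Finset.sdiff_subset hu')))
        (by have := hrem {v} (Finset.singleton_subset_iff.2 hv); omega) hF
      refine ⟨T1 ∪ T2, ?_, ?_, ?_⟩
      · refine (Finset.card_union_le _ _).trans ((Nat.add_le_add hT1 hT2).trans ?_)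
        have : (m + 1) ^ q ≤ (m + 1 + 1) ^ q := Nat.pow_le_pow_left (by omega) q
        rw [pow_succ, pow_succ]
        nlinarith
      · intro C hC
        rcases Finset.mem_union.1 hC with h | h
        exacts [hT1' C h, hT2' C h]
      · intro I hI hS hsub
        by_cases hvI : v ∈ I
        · obtain ⟨C, hC, h⟩ := hT1'' I hI hS hsub hvI
          exact ⟨C, Finset.mem_union_left _ hC, h⟩
        · obtain ⟨C, hC, h⟩ := hT2'' I hI hS (by
            intro x hx
            have hxv : x ≠ v := fun e => hvI (e ▸ hx)
            have := hsub x hx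
            simp only [Finset.mem_union, Finset.mem_sdiff, Finset.mem_singleton] at this ⊢
            tauto)
          exact ⟨C, Finset.mem_union_right _ hC, h⟩
    by_cases hfull : ∃ v ∈ A, k ≤ d2 R S A v
    · -- type 1
      obtain ⟨v, hv, hvk⟩ := hfull
      set B : Finset V := insert v (A.filter (fun w => ∃ s ∈ S, R s v w)) with hBdef
      have hB : B ⊆ A := Finset.insert_subset hv (Finset.filter_subset _ _)
      have hvN : v ∉ A.filter (fun w => ∃ s ∈ S, R s v w) := by
        intro h
        obtain ⟨_, s, _, hR⟩ := Finset.mem_filter.1 h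
        exact hne v v s (h2 _ _ _ (h1 _ _ _ hR)) rfl
      have hBc : k + 1 ≤ B.card := by
        rw [hBdef, Finset.card_insert_of_notMem hvN]
        exact Nat.succ_le_succ hvk
      have hr := hrem B hB
      have hkB : k * (k + 1) ≤ k * B.card := Nat.mul_le_mul_left _ hBc
      have hc := Finset.card_sdiff_add_card_eq_card hB
      obtain ⟨T, hT, hT', hT''⟩ := ih q (A \ B) (insert v F) S (by omega)
        (hdis.mono_right Finset.sdiff_subset)
        (fun u hu' => (d2_mono R S A _ Finset.sdiff_subset u).trans
          (hd u (Finset.sdiff_subset hu')))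
        (by rw [add_mul] at hr; omega)
        (by have := Finset.card_insert_le v F; omega)
      refine ⟨v, hv, T, hT, hT', ?_⟩
      intro I hI hS hsub hvI
      refine hT'' I hI hS ?_
      intro x hx
      have h0 := hsub x hx
      have hxN : x ∉ A.filter (fun w => ∃ s ∈ S, R s v w) := by
        intro h
        obtain ⟨_, s, hs, hR⟩ := Finset.mem_filter.1 h
        exact hI s (hS s hs) v hvI x hx hR
      rw [Finset.mem_union, Finset.mem_sdiff, hBdef, Finset.mem_insert, Finset.mem_insert]
      rw [Finset.mem_union] at h0
      tauto
    · -- type 2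
      push Not at hfull
      have hr := hrem {v0} (Finset.singleton_subset_iff.2 hv0)
      have hv0S : v0 ∉ S := fun h => Finset.disjoint_left.1 hdis h hv0
      have hi := ee_insert R h1 h2 hne hu S A v0 hv0S
      have hvc := Finset.card_sdiff_add_card_eq_card (Finset.singleton_subset_iff.2 hv0)
      rw [Finset.card_singleton] at hvc
      obtain ⟨T, hT, hT', hT''⟩ := ih q (A \ {v0}) (insert v0 F) (insert v0 S) (by omega)
        (by
          rw [Finset.disjoint_insert_left]
          exact ⟨by simp, hdis.mono_right Finset.sdiff_subset⟩)
        (fun u hu' => by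
          have a1 := d2_insert R hu S (A \ {v0}) v0 u
          have a2 := d2_mono R S A _ (Finset.sdiff_subset (t := {v0})) u
          have a3 := hfull u (Finset.sdiff_subset hu')
          omega)
        (by rw [add_mul] at hr; omega)
        (by have := Finset.card_insert_le v0 F; omega)
      refine ⟨v0, hv0, T, hT, hT', ?_⟩
      intro I hI hS hsub hvI
      refine hT'' I hI ?_ ?_
      · intro s hs
        rcases Finset.mem_insert.1 hs with rfl | hs
        exacts [hvI, hS s hs]
      · intro x hx
        have h0 := hsub x hx
        rw [Finset.mem_union, Finset.mem_sdiff, Finset.mem_insert, Finset.mem_singleton]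
        rw [Finset.mem_union] at h0
        tauto

/-- triangle relation on edges -/
def Tri {n : ℕ} (e f g : Sym2 (Fin n)) : Prop :=
  ∃ x y z : Fin n, x ≠ y ∧ y ≠ z ∧ x ≠ z ∧ e = s(x, y) ∧ f = s(y, z) ∧ g = s(x, z)

theorem tri1 {n : ℕ} (a b c : Sym2 (Fin n)) (h : Tri a b c) : Tri b a c := by
  obtain ⟨x, y, z, h1, h2, h3, rfl, rfl, rfl⟩ := h
  exact ⟨z, y, x, h2.symm, h1.symm, h3.symm, Sym2.eq_swap, Sym2.eq_swap, Sym2.eq_swap⟩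

theorem tri2 {n : ℕ} (a b c : Sym2 (Fin n)) (h : Tri a b c) : Tri a c b := by
  obtain ⟨x, y, z, h1, h2, h3, rfl, rfl, rfl⟩ := h
  exact ⟨y, x, z, h1.symm, h3, h2, Sym2.eq_swap, rfl, rfl⟩

theorem tri_ne {n : ℕ} (a b c : Sym2 (Fin n)) (h : Tri a b c) : a ≠ b := by
  obtain ⟨x, y, z, h1, h2, h3, rfl, rfl, rfl⟩ := h
  rw [Ne, Sym2.eq_iff]
  tauto

theorem tri_uniq {n : ℕ} (a b c c' : Sym2 (Fin n)) (h : Tri a b c) (h' : Tri a b c') :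
    c = c' := by
  obtain ⟨x, y, z, h1, h2, h3, rfl, rfl, rfl⟩ := h
  obtain ⟨x', y', z', h1', h2', h3', e1, e2, rfl⟩ := h'
  rw [Sym2.eq_iff] at e1 e2 ⊢
  grind

open Classical in
theorem tri_count {n : ℕ} (A F : Finset (Sym2 (Fin n))) (D : ℕ) (h : ∀ v ∈ A, d1 Tri A v < D) :
    triangleCount (SimpleGraph.fromEdgeSet (↑(A ∪ F) : Set (Sym2 (Fin n)))) ≤
      A.card * D + F.card * n := by
  set G := SimpleGraph.fromEdgeSet (↑(A ∪ F) : Set (Sym2 (Fin n)))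
  have e : triangleCount G = (Finset.univ.filter (fun s => G.IsNClique 3 s)).card := by
    unfold triangleCount
    rw [Nat.card_eq_fintype_card, Fintype.card_subtype]
  set T1 := (A ×ˢ (A ×ˢ A)).filter (fun p => Tri p.1 p.2.1 p.2.2)
  have hT1 : T1.card ≤ A.card * D := by
    have : T1.card = ∑ v ∈ A, d1 Tri A v := by
      simp only [T1, d1]
      rw [Finset.card_filter, Finset.sum_product]
      refine Finset.sum_congr rfl fun x _ => ?_
      rw [Finset.card_filter]
    rw [this]
    exact Finset.sum_le_card_nsmul A _ D (fun v hv => (h v hv).le)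
  let f1 : Sym2 (Fin n) × Sym2 (Fin n) × Sym2 (Fin n) → Finset (Fin n) :=
    fun p => p.1.toFinset ∪ p.2.1.toFinset
  let f2 : Sym2 (Fin n) × Fin n → Finset (Fin n) := fun p => p.1.toFinset ∪ {p.2}
  have hsub : Finset.univ.filter (fun s => G.IsNClique 3 s) ⊆
      T1.image f1 ∪ (F ×ˢ (Finset.univ : Finset (Fin n))).image f2 := by
    intro s hs
    rw [Finset.mem_filter, SimpleGraph.is3Clique_iff] at hs
    obtain ⟨_, x, y, z, hxy, hxz, hyz, rfl⟩ := hs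
    simp only [G, SimpleGraph.fromEdgeSet_adj, Finset.mem_coe, Finset.mem_union] at hxy hxz hyz
    rw [Finset.mem_union]
    by_cases c1 : s(x, y) ∈ F
    · right
      refine Finset.mem_image.2 ⟨(s(x, y), z), by simp [c1], ?_⟩
      ext; simp [f2]; try tauto
    by_cases c2 : s(x, z) ∈ F
    · right
      refine Finset.mem_image.2 ⟨(s(x, z), y), by simp [c2], ?_⟩
      ext; simp [f2]; try tauto
    by_cases c3 : s(y, z) ∈ F
    · right
      refine Finset.mem_image.2 ⟨(s(y, z), x), by simp [c3], ?_⟩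
      ext; simp [f2]; try tauto
    left
    refine Finset.mem_image.2 ⟨(s(x, y), s(y, z), s(x, z)), ?_, ?_⟩
    · simp only [T1, Finset.mem_filter, Finset.mem_product]
      exact ⟨⟨by tauto, by tauto, by tauto⟩, x, y, z, hxy.2, hyz.2, hxz.2, rfl, rfl, rfl⟩
    · ext; simp [f1]; try tauto
  rw [e]
  refine (Finset.card_le_card hsub).trans ((Finset.card_union_le _ _).trans ?_)
  refine Nat.add_le_add (Finset.card_image_le.trans hT1) (Finset.card_image_le.trans ?_)
  simp

theorem combined (n k D Q : ℕ) (hk : 1 ≤ k) (hD : D ≤ k * (k + 1))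
    (hQ : 3 * (k * n ^ 2) ≤ Q * D) :
    ∃ (t : ℕ) (G : Fin t → SimpleGraph (Fin n)), t ≤ (n ^ 2 + 1) ^ Q ∧
      (∀ i, triangleCount (G i) ≤ n ^ 2 * D + Q * n) ∧
      (∀ H : SimpleGraph (Fin n), H.CliqueFree 3 → ∃ i : Fin t, H ≤ G i) := by
  classical
  have hV : (Finset.univ : Finset (Sym2 (Fin n))).card ≤ n ^ 2 := by
    rw [Finset.card_univ, Sym2.card, Fintype.card_fin, Nat.choose_two_right]
    apply Nat.div_le_of_le_mul
    simp only [Nat.add_sub_cancel]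
    nlinarith [Nat.zero_le n, sq_nonneg n, Nat.le_mul_self n]
  obtain ⟨T, hT, hT', hT''⟩ := cov (Tri (n := n)) tri1 tri2 tri_ne tri_uniq k D Q hk hD
    (n ^ 2) Q Finset.univ ∅ ∅ hV (Finset.disjoint_empty_left _) (by simp [d2])
    (by have := Nat.mul_le_mul_left k hV; omega) (by simp)
  refine ⟨T.card, fun i => SimpleGraph.fromEdgeSet (↑(T.equivFin.symm i : Finset (Sym2 (Fin n)))),
    hT, ?_, ?_⟩
  · intro i
    obtain ⟨A, F, hC, hF, hd⟩ := hT' _ (T.equivFin.symm i).2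
    have hC' : (T.equivFin.symm i : Finset (Sym2 (Fin n))) = A ∪ F := by
      rw [hC]; ext x; simp only [Finset.mem_union]
    beta_reduce
    rw [hC']
    refine (tri_count A F D hd).trans ?_
    have hA : A.card ≤ n ^ 2 := (Finset.card_le_univ A).trans hV
    exact Nat.add_le_add (Nat.mul_le_mul_right _ hA) (Nat.mul_le_mul_right _ hF)
  · intro H hH
    obtain ⟨C, hC, hsub⟩ := hT'' H.edgeSet (by
      rintro a ha b hb c hc ⟨x, y, z, h1, h2, h3, rfl, rfl, rfl⟩
      exact hH {x, y, z} (SimpleGraph.is3Clique_iff.2 ⟨x, y, z, ha, hc, hb, rfl⟩))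
      (by simp) (by simp)
    refine ⟨T.equivFin ⟨C, hC⟩, ?_⟩
    intro x y hxy
    simp only [Equiv.symm_apply_apply, SimpleGraph.fromEdgeSet_adj, Finset.mem_coe]
    exact ⟨hsub _ hxy, hxy.ne⟩

end ContainerAux

/-- Container corollary of Balogh–Morris–Samotij / Saxton–Thomason: for every `δ > 0`
there are a constant `C > 0` and `N` such that for every `n ≥ N` there is a family
`G_1, …, G_t` of graphs on `Fin n` with `t ≤ 2 ^ (C (log n) n^(3/2))`, each `G_i`
containing at most `δ n^3` triangles, such that every triangle-free graph `H` on `Fin n`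
is a subgraph of some `G_i`. -/
theorem container_theorem :
    ∀ δ : ℝ, 0 < δ → ∃ C : ℝ, 0 < C ∧ ∃ N : ℕ, ∀ n : ℕ, N ≤ n →
      ∃ (t : ℕ) (G : Fin t → SimpleGraph (Fin n)),
        (t : ℝ) ≤ 2 ^ (C * Real.log n * (n : ℝ) ^ ((3 : ℝ) / 2)) ∧
        (∀ i : Fin t, (triangleCount (G i) : ℝ) ≤ δ * (n : ℝ) ^ 3) ∧
        (∀ H : SimpleGraph (Fin n), H.CliqueFree 3 → ∃ i : Fin t, H ≤ G i) := by
  intro δ hδ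
  obtain ⟨c, hc, hc1, hc2⟩ : ∃ c : ℝ, 0 < c ∧ c ≤ 1 / 2 ∧ c ≤ δ / 4 :=
    ⟨min (1 / 2) (δ / 4), by positivity, min_le_left _ _, min_le_right _ _⟩
  refine ⟨42 / c, by positivity, max 2 (max ⌈1 / c⌉₊ ⌈(14 / (c * δ)) ^ 2⌉₊), ?_⟩
  intro n hn
  have hn2 : 2 ≤ n := (le_max_left _ _).trans hn
  have hnc : 1 / c ≤ n := Nat.ceil_le.1 (((le_max_left _ _).trans (le_max_right _ _)).trans hn)
  have hnd : (14 / (c * δ)) ^ 2 ≤ n :=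
    Nat.ceil_le.1 (((le_max_right _ _).trans (le_max_right _ _)).trans hn)
  have hnR : (2 : ℝ) ≤ n := by exact_mod_cast hn2
  have hcn : 1 ≤ c * n := by rwa [div_le_iff₀' hc] at hnc
  set r := Real.sqrt n with hr
  have hrr : r * r = n := Real.mul_self_sqrt (by positivity)
  have hr1 : 1 ≤ r := by rw [hr, Real.one_le_sqrt]; linarith
  have hrd : 14 / (c * δ) ≤ r := Real.le_sqrt_of_sq_le hnd
  have hpow : (n : ℝ) ^ ((3 : ℝ) / 2) = n * r := by
    rw [hr, Real.sqrt_eq_rpow, show (3 : ℝ) / 2 = 1 + 1 / 2 by norm_num,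
      Real.rpow_add (by linarith), Real.rpow_one]
  set D := ⌈c * n⌉₊ with hDdef
  have hD1 : c * n ≤ D := Nat.le_ceil _
  have hD2 : (D : ℝ) ≤ 2 * (c * n) := by
    have := Nat.ceil_lt_add_one (a := c * n) (by positivity)
    linarith
  have hDn : D ≤ n := by
    have : (D : ℝ) ≤ n := by nlinarith
    exact_mod_cast this
  set k := Nat.sqrt n + 1 with hk
  have hkk : n < k * k := Nat.lt_succ_sqrt n
  have hk2 : (k : ℝ) ≤ 2 * r := by
    have : ((Nat.sqrt n : ℕ) : ℝ) ≤ r := Real.nat_sqrt_le_real_sqrt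
    rw [hk]; push_cast; linarith
  set Q := ⌈6 * (n * r) / c⌉₊ with hQdef
  have hQ1 : 6 * (n * r) / c ≤ Q := Nat.le_ceil _
  have hQ2 : (Q : ℝ) ≤ 7 * (n * r) / c := by
    have := Nat.ceil_lt_add_one (a := 6 * (n * r) / c) (by positivity)
    have h1 : 1 ≤ (n * r) / c := by
      rw [le_div_iff₀ hc]; nlinarith
    have : 7 * (n * r) / c = 6 * (n * r) / c + (n * r) / c := by ring
    linarith
  obtain ⟨t, G, ht, hG, hH⟩ := ContainerAux.combined n k D Q (by omega) (by nlinarith) (by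
    have : (3 * (k * n ^ 2) : ℝ) ≤ Q * D := by
      calc (3 * (k * n ^ 2) : ℝ) ≤ 3 * (2 * r * n ^ 2) := by gcongr
        _ = (6 * (n * r) / c) * (c * n) := by field_simp; ring
        _ ≤ Q * D := by gcongr
    exact_mod_cast this)
  refine ⟨t, G, ?_, ?_, hH⟩
  · have hlog : 0 ≤ Real.log n := Real.log_nonneg (by linarith)
    have hl2 : (1 : ℝ) / 2 ≤ Real.log 2 := by linarith [Real.log_two_gt_d9]
    have h1 : (t : ℝ) ≤ ((n : ℝ) ^ 3) ^ Q := by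
      have : t ≤ (n ^ 3) ^ Q := ht.trans (Nat.pow_le_pow_left (by nlinarith [sq_nonneg n, Nat.mul_le_mul_left (n^2) hn2, Nat.one_le_pow 2 n (by omega)]) Q)
      exact_mod_cast this
    refine h1.trans ?_
    rw [hpow, ← pow_mul, ← Real.rpow_natCast, Real.rpow_def_of_pos (by linarith),
      Real.rpow_def_of_pos (by norm_num), Real.exp_le_exp]
    push_cast
    calc Real.log n * (3 * Q) ≤ Real.log n * (3 * (7 * (n * r) / c)) := by gcongr
      _ = (1 / 2) * (42 / c * Real.log n * (n * r)) := by ring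
      _ ≤ Real.log 2 * (42 / c * Real.log n * (n * r)) := by gcongr
  · intro i
    have h1 : (triangleCount (G i) : ℝ) ≤ n ^ 2 * D + Q * n := by exact_mod_cast hG i
    have h2 : (n : ℝ) ^ 2 * D ≤ δ / 2 * n ^ 3 := by
      calc (n : ℝ) ^ 2 * D ≤ n ^ 2 * (2 * (c * n)) := by gcongr
        _ = (2 * c) * n ^ 3 := by ring
        _ ≤ δ / 2 * n ^ 3 := by gcongr; linarith
    have h3 : (Q : ℝ) * n ≤ δ / 2 * n ^ 3 := by
      have h14 : 7 / c ≤ δ / 2 * r := by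
        rw [div_le_iff₀ (by positivity)] at hrd ⊢
        nlinarith
      calc (Q : ℝ) * n ≤ 7 * (n * r) / c * n := by gcongr
        _ = 7 / c * (n ^ 2 * r) := by ring
        _ ≤ δ / 2 * r * (n ^ 2 * r) := by gcongr
        _ = δ / 2 * n ^ 2 * (r * r) := by ring
        _ = δ / 2 * n ^ 3 := by rw [hrr]; ring
    linarith
end
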